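/- Let n = 2 and let P₁Mon = {a ∈ S₂ : a₂ ≥ 1} be the set of exponents of monomials in the prime ideal P₁ = ⟨st, st²⟩ of R_{A₂} = ℂ[s, st, st²]. For every d = (d₁,d₂) ∈ ℤ², the vanishing ideal in ℂ[θ₁,θ₂] of the set {a ∈ S₂ : a + d ∉ P₁Mon} is the principal ideal generated by E₁ · (H₂, −2d₁+d₂−1)!, where E₁ = (H₁, −d₂)! if d₂ ≤ 0 and E₁ = 1 if d₂ > 0. (This computes all graded pieces of D(R_{A₂}, P₁).) -/

import Mathlib

open MvPolynomial

noncomputable section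

/-- The polynomial ring ℂ[θ₁, θ₂]. -/
abbrev Cθ : Type := MvPolynomial (Fin 2) ℂ

/-- The vanishing ideal of a set `V ⊆ ℤ²` inside ℂ[θ₁, θ₂]. -/
def vanishingIdeal (V : Set (ℤ × ℤ)) : Ideal Cθ where
  carrier := {f | ∀ a ∈ V, eval ![(a.1 : ℂ), (a.2 : ℂ)] f = 0}
  add_mem' := by
    intro f g hf hg a ha
    simp [map_add, hf a ha, hg a ha]
  zero_mem' := by
    intro a _
    simp
  smul_mem' := by
    intro c f hf a ha
    simp [smul_eq_mul, hf a ha]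

/-- The descending factorial `(P, m)! = ∏_{j=0}^{m} (P - j)`, equal to `1` when `m < 0`. -/
def dfact (P : Cθ) (m : ℤ) : Cθ :=
  ∏ j ∈ Finset.range (m + 1).toNat, (P - C (j : ℂ))

/-- The saturated affine semigroup `S_n = {(x, y) ∈ ℤ² : 0 ≤ y ≤ n x}` of the rational
normal curve of degree `n`. -/
def Sset (n : ℤ) : Set (ℤ × ℤ) := {a | 0 ≤ a.2 ∧ a.2 ≤ n * a.1}

/-- `Ω(d) = {a ∈ S_n : a + d ∉ S_n}`. -/
def Omega (n : ℤ) (d : ℤ × ℤ) : Set (ℤ × ℤ) := {a | a ∈ Sset n ∧ a + d ∉ Sset n}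

/-- `JMon_n = {a ∈ S_n : h₁(a) > 0 and h₂(a) > 0}`, the exponents of the monomials of the
radical interior ideal `J = ⟨st, …, stⁿ⁻¹⟩`. -/
def JMon (n : ℤ) : Set (ℤ × ℤ) := {a | a ∈ Sset n ∧ 0 < a.2 ∧ 0 < n * a.1 - a.2}

/-- `P₁Mon = {a ∈ S₂ : a₂ ≥ 1}`, the exponents of monomials in the facet prime
`P₁ = ⟨st, st²⟩` of `R_{A₂}`. -/
def P1Mon : Set (ℤ × ℤ) := {a | a ∈ Sset 2 ∧ 1 ≤ a.2}

/-- The polynomial `y - q(x)` cutting out the graph of a univariate polynomial `q`. -/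
def graphPoly (q : Polynomial ℂ) : Cθ := X 1 - Polynomial.aeval (X 0) q

/-- Restriction of a bivariate polynomial to the graph of `q`. -/
def restrictGraph (q : Polynomial ℂ) : Cθ →ₐ[ℂ] Polynomial ℂ := aeval ![Polynomial.X, q]

theorem eval_restrictGraph (q : Polynomial ℂ) (f : Cθ) (x : ℂ) :
    (restrictGraph q f).eval x = eval ![x, q.eval x] f := by
  have h : (Polynomial.aeval x).comp (restrictGraph q) = aeval ![x, q.eval x] := by
    ext i
    fin_cases i <;> simp [restrictGraph]
  simpa [Polynomial.aeval_def, Polynomial.eval₂_eq_eval_map, aeval_eq_eval] using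
    DFunLike.congr_fun h f

theorem restrictGraph_aeval (p q : Polynomial ℂ) :
    restrictGraph p (Polynomial.aeval (X 0) q) = q := by
  have h : (restrictGraph p).comp (Polynomial.aeval (X 0)) = AlgHom.id ℂ _ := by
    ext
    simp [restrictGraph]
  exact DFunLike.congr_fun h q

theorem graphPoly_dvd_iff (q : Polynomial ℂ) (f : Cθ) :
    graphPoly q ∣ f ↔ restrictGraph q f = 0 := by
  constructor
  · rintro ⟨g, rfl⟩
    rw [map_mul, graphPoly, map_sub, restrictGraph_aeval]
    simp [restrictGraph]
  · intro hf
    have h : (Ideal.Quotient.mkₐ ℂ (Ideal.span {graphPoly q})).comp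
        ((Polynomial.aeval (X 0)).comp (restrictGraph q)) =
        Ideal.Quotient.mkₐ ℂ (Ideal.span {graphPoly q}) := by
      ext i
      fin_cases i
      · simp [restrictGraph]
      · simp only [restrictGraph, AlgHom.comp_apply, Ideal.Quotient.mkₐ_eq_mk, Fin.mk_one, aeval_X,
          Matrix.cons_val_one, Matrix.cons_val_fin_one]
        rw [eq_comm, Ideal.Quotient.eq]
        exact Ideal.mem_span_singleton_self _
    have h' := DFunLike.congr_fun h f
    simp only [AlgHom.comp_apply, hf, map_zero, Ideal.Quotient.mkₐ_eq_mk] at h'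
    exact Ideal.mem_span_singleton.1 (Ideal.Quotient.eq_zero_iff_mem.1 h'.symm)

theorem graphPoly_dvd_graphPoly_iff (p q : Polynomial ℂ) :
    graphPoly p ∣ graphPoly q ↔ p = q := by
  rw [graphPoly_dvd_iff, graphPoly, map_sub, restrictGraph_aeval, sub_eq_zero]
  simp [restrictGraph]

theorem prime_graphPoly (q : Polynomial ℂ) : Prime (graphPoly q) := by
  refine ⟨fun h => ?_, fun h => ?_, fun a b h => ?_⟩
  · have := (graphPoly_dvd_graphPoly_iff (q + 1) q).1 (h ▸ dvd_zero _)
    simp at this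
  · have := (graphPoly_dvd_iff q 1).1 h.dvd
    simp at this
  · simpa only [graphPoly_dvd_iff, map_mul, mul_eq_zero] using h

theorem isRelPrime_graphPoly {p q : Polynomial ℂ} (h : p ≠ q) :
    IsRelPrime (graphPoly p) (graphPoly q) :=
  (prime_graphPoly p).irreducible.isRelPrime_iff_not_dvd.2
    (mt (graphPoly_dvd_graphPoly_iff p q).1 h)

/-- A polynomial vanishing at almost all natural points of a graph is divisible by the
equation of the graph. -/
theorem graphPoly_dvd_of_eval_eq_zero {q : Polynomial ℂ} {f : Cθ} (N : ℕ)
    (h : ∀ n : ℕ, N ≤ n → eval ![(n : ℂ), q.eval (n : ℂ)] f = 0) : graphPoly q ∣ f := by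
  rw [graphPoly_dvd_iff]
  refine Polynomial.eq_zero_of_infinite_isRoot _ ?_
  refine ((Set.Ici_infinite N).image (Nat.cast_injective (R := ℂ)).injOn).mono ?_
  rintro _ ⟨n, hn, rfl⟩
  exact (eval_restrictGraph q f n).trans (h n hn)

theorem X_one_sub_C_eq_graphPoly (c : ℂ) : (X 1 - C c : Cθ) = graphPoly (Polynomial.C c) := by
  simp [graphPoly, algebraMap_eq]

theorem two_X_sub_X_sub_C_eq_neg_graphPoly (c : ℂ) :
    (C (2 : ℂ) * X 0 - X 1 - C c : Cθ) =
      -graphPoly (Polynomial.C 2 * Polynomial.X - Polynomial.C c) := by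
  simp only [graphPoly, map_sub, map_mul, Polynomial.aeval_C, Polynomial.aeval_X, algebraMap_eq]
  ring

theorem eval_dfact_eq_zero {P : Cθ} {m k : ℤ} {v : Fin 2 → ℂ} (hv : eval v P = k)
    (h0 : 0 ≤ k) (hk : k ≤ m) : eval v (dfact P m) = 0 := by
  rw [dfact, map_prod]
  refine Finset.prod_eq_zero (i := k.toNat) (by simp; omega) ?_
  rw [map_sub, hv, eval_C, sub_eq_zero]
  exact_mod_cast (Int.toNat_of_nonneg h0).symm

theorem dfact_dvd {P f : Cθ} {m : ℤ}
    (hP : Pairwise fun i j : ℕ => IsRelPrime (P - C (i : ℂ)) (P - C (j : ℂ)))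
    (h : ∀ j : ℕ, (j : ℤ) ≤ m → P - C (j : ℂ) ∣ f) : dfact P m ∣ f :=
  Finset.prod_dvd_of_isRelPrime (fun _ _ _ _ hij => hP hij) fun j hj =>
    h j (by rw [Finset.mem_range] at hj; omega)

theorem isRelPrime_dfact {P Q : Cθ} {m n : ℤ}
    (h : ∀ i j : ℕ, IsRelPrime (P - C (i : ℂ)) (Q - C (j : ℂ))) :
    IsRelPrime (dfact P m) (dfact Q n) :=
  IsRelPrime.prod_left fun i _ => IsRelPrime.prod_right fun j _ => h i j

theorem dfact_of_neg (P : Cθ) {m : ℤ} (hm : m < 0) : dfact P m = 1 := by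
  simp [dfact, show (m + 1).toNat = 0 by omega]

/-- All graded pieces of `D(R_{A₂}, P₁)` for `R_{A₂} = ℂ[s, st, st²]`: the vanishing
ideal of `{a ∈ S₂ : a + d ∉ P₁Mon}` is principal, generated by
`E₁ · (H₂, −2d₁+d₂−1)!` with `E₁ = (H₁, −d₂)!` when `d₂ ≤ 0` and `E₁ = 1` otherwise. -/
theorem statement9 (d : ℤ × ℤ) :
    vanishingIdeal {a | a ∈ Sset 2 ∧ a + d ∉ P1Mon} =
      Ideal.span
        {(if d.2 ≤ 0 then dfact (X 1) (-d.2) else 1) *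
          dfact (C (2 : ℂ) * X 0 - X 1) (-(2 * d.1) + d.2 - 1)} := by
  have hE : (if d.2 ≤ 0 then dfact (X 1) (-d.2) else 1) = dfact (X 1) (-d.2) := by
    split_ifs with h
    · rfl
    · exact (dfact_of_neg _ (by omega)).symm
  rw [hE]
  ext f
  rw [Ideal.mem_span_singleton]
  constructor
  · intro hf
    refine IsRelPrime.mul_dvd (isRelPrime_dfact fun i j => ?_)
      (dfact_dvd (fun i j hij => ?_) fun j hj => ?_)
      (dfact_dvd (fun i j hij => ?_) fun j hj => ?_)
    · rw [X_one_sub_C_eq_graphPoly, two_X_sub_X_sub_C_eq_neg_graphPoly, IsRelPrime.neg_right_iff]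
      refine isRelPrime_graphPoly fun h => ?_
      have := congrArg (Polynomial.coeff · 1) h
      simp [Polynomial.coeff_C] at this
    · simp only [X_one_sub_C_eq_graphPoly]
      exact isRelPrime_graphPoly (by simpa using hij)
    · rw [X_one_sub_C_eq_graphPoly]
      refine graphPoly_dvd_of_eval_eq_zero j fun n hn => ?_
      have := hf ((n : ℤ), (j : ℤ)) (by
        simp only [Set.mem_ofPred_eq, Sset, P1Mon, Prod.fst_add, Prod.snd_add]
        omega)
      simpa using this
    · simp only [two_X_sub_X_sub_C_eq_neg_graphPoly, IsRelPrime.neg_right_iff,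
        IsRelPrime.neg_left_iff]
      exact isRelPrime_graphPoly (by simpa using hij)
    · rw [two_X_sub_X_sub_C_eq_neg_graphPoly, neg_dvd]
      refine graphPoly_dvd_of_eval_eq_zero j fun n hn => ?_
      have := hf ((n : ℤ), 2 * (n : ℤ) - (j : ℤ)) (by
        simp only [Set.mem_ofPred_eq, Sset, P1Mon, Prod.fst_add, Prod.snd_add]
        omega)
      simpa using this
  · rintro ⟨g, rfl⟩ a ⟨ha, had⟩
    simp only [Sset, P1Mon, Set.mem_ofPred_eq, Prod.fst_add, Prod.snd_add] at ha had
    rw [map_mul, map_mul]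
    by_cases h : a.2 ≤ -d.2
    · rw [eval_dfact_eq_zero (k := a.2) (by simp) ha.1 h, zero_mul, zero_mul]
    · rw [eval_dfact_eq_zero (P := C 2 * X 0 - X 1) (k := 2 * a.1 - a.2) (by simp) (by omega)
        (by omega), mul_zero, zero_mul]

end
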